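/- The graph A8 contains the wheel W_5 as an induced subgraph; consequently A8 is not 3-colourable and is not word-representable. -/

import Mathlib

/-- Two distinct letters `x` and `y` alternate in the word `w` if, after deleting all
letters other than `x` and `y` from `w`, no two consecutive letters of the resulting
word are equal (i.e. it reads `xyxy...` or `yxyx...`). -/
def Alternates {V : Type*} [DecidableEq V] (w : List V) (x y : V) : Prop :=
  List.Chain' (· ≠ ·) (w.filter fun z => z = x ∨ z = y)

/-- A finite simple graph `G = (V, E)` is word-representable if there is a word over the
alphabet `V` in which every element of `V` occurs at least once and such that, for all
distinct `x, y ∈ V`, the letters `x` and `y` alternate in the word iff `{x, y} ∈ E`. -/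
def WordRepresentable {V : Type*} [DecidableEq V] (G : SimpleGraph V) : Prop :=
  ∃ w : List V, (∀ v : V, v ∈ w) ∧
    ∀ x y : V, x ≠ y → (G.Adj x y ↔ Alternates w x y)

/-- The wheel graph `W_n` on `n + 1` vertices: a cycle on the `n` vertices `Sum.inl i`
(`i : Fin n`), together with one new hub vertex `Sum.inr ()` adjacent to all of them. -/
def wheelGraph (n : ℕ) : SimpleGraph (Fin n ⊕ Unit) :=
  SimpleGraph.fromRel fun a b =>
    match a, b with
    | Sum.inl i, Sum.inl j => ((i : ℕ) + 1) % n = (j : ℕ)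
    | Sum.inl _, Sum.inr _ => True
    | _, _ => False

/-- The simple graph on `V` whose edges are (the unordered versions of) the pairs
occurring in the list `l`. -/
def graphOfList {V : Type*} (l : List (V × V)) : SimpleGraph V :=
  SimpleGraph.fromRel fun a b => (a, b) ∈ l

def edgesA8 : List ((Fin 4 × Fin 3) × (Fin 4 × Fin 3)) :=
  [
    ((0, 0), (1, 0)), ((0, 0), (0, 1)), ((0, 1), (1, 1)), ((0, 1), (0, 2)), ((0, 2), (1, 2)),
    ((1, 0), (2, 0)), ((1, 0), (1, 1)), ((1, 1), (2, 1)), ((1, 1), (1, 2)), ((1, 2), (2, 2)),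
    ((2, 0), (2, 1)), ((2, 1), (3, 1)), ((2, 2), (3, 2)), ((3, 1), (3, 2)), ((0, 1), (1, 2)),
    ((0, 1), (1, 0)), ((1, 1), (2, 0)), ((1, 2), (2, 1)), ((1, 2), (3, 1)), ((2, 2), (3, 1))]

/-- The graph `A8` from the paper, with vertex set
`{(x,y) : 0 ≤ x ≤ 3, 0 ≤ y ≤ 2} \ {(3, 0)}`. -/
def graphA8 : SimpleGraph {p : Fin 4 × Fin 3 | p ≠ (3, 0)} :=
  (graphOfList edgesA8).induce {p : Fin 4 × Fin 3 | p ≠ (3, 0)}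

def Dom {V : Type*} [DecidableEq V] (w : List V) (x y : V) : Prop :=
  ∀ p, p <+: w → p.count y ≤ p.count x ∧ p.count x ≤ p.count y + 1

theorem dom_cons_left {V : Type*} [DecidableEq V] (l : List V) (x y : V) (h : x ≠ y) :
    Dom (x :: l) x y ↔ Dom l y x := by
  constructor
  · intro H p hp
    have := H (x :: p) (by simpa using hp)
    simp [List.count_cons, h] at this
    omega
  · intro H p hp
    rcases List.prefix_cons_iff.1 hp with rfl | ⟨t, rfl, ht⟩
    · simp
    · have := H t ht
      simp [List.count_cons, h]
      omega

theorem dom_cons_right {V : Type*} [DecidableEq V] (l : List V) (x y : V) (h : x ≠ y) :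
    ¬ Dom (y :: l) x y := by
  intro H
  have := H [y] (by simp)
  simp [h.symm] at this

theorem dom_cons_other {V : Type*} [DecidableEq V] (l : List V) (a x y : V)
    (hx : a ≠ x) (hy : a ≠ y) :
    Dom (a :: l) x y ↔ Dom l x y := by
  constructor
  · intro H p hp
    have := H (a :: p) (by simpa using hp)
    simpa [List.count_cons, hx, hy] using this
  · intro H p hp
    rcases List.prefix_cons_iff.1 hp with rfl | ⟨t, rfl, ht⟩
    · simp
    · have := H t ht
      simpa [List.count_cons, hx, hy] using this

theorem chain_dom {V : Type*} [DecidableEq V] (w : List V) : ∀ (x y : V), x ≠ y →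
    ((List.IsChain (· ≠ ·) (y :: w.filter fun z => z = x ∨ z = y) ↔ Dom w x y) ∧
    (List.IsChain (· ≠ ·) (x :: w.filter fun z => z = x ∨ z = y) ↔ Dom w y x)) := by
  induction w with
  | nil => intro x y h; simp [Dom]
  | cons a l ih =>
    intro x y h
    have := ih x y h
    by_cases hx : a = x
    · subst hx
      rw [dom_cons_left _ _ _ h]
      have h2 := dom_cons_right l y a h.symm
      simp only [h2]
      simp [h.symm] at this ⊢
      exact this.2
    · by_cases hy : a = y
      · subst hy
        rw [dom_cons_left _ _ _ h.symm]
        have h2 := dom_cons_right l x a h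
        simp only [h2]
        simp [h] at this ⊢
        exact this.1
      · rw [dom_cons_other _ _ _ _ hx hy, dom_cons_other _ _ _ _ hy hx]
        simpa [hx, hy] using this

theorem alternates_iff {V : Type*} [DecidableEq V] (w : List V) (x y : V) (h : x ≠ y) :
    Alternates w x y ↔ (Dom w x y ∨ Dom w y x) := by
  rw [← (chain_dom w x y h).1, ← (chain_dom w x y h).2]
  show List.IsChain _ _ ↔ _
  have hm : ∀ z ∈ w.filter (fun z => z = x ∨ z = y), z = x ∨ z = y := by
    intro z hz; simpa using (List.mem_filter.1 hz).2
  generalize w.filter (fun z => z = x ∨ z = y) = l at *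
  cases l with
  | nil => simp
  | cons a t =>
    rcases hm a (by simp) with rfl | rfl
    · simp [h.symm]
    · simp [h]

/-- shifted domination -/
def SDom {V : Type*} [DecidableEq V] (w : List V) (e : V → ℕ) (x y : V) : Prop :=
  ∀ p, p <+: w → p.count y + e y ≤ p.count x + e x ∧ p.count x + e x ≤ p.count y + e y + 1

theorem exists_shift {V : Type*} [DecidableEq V] (w : List V) (h : V) :
    ∃ e : V → ℕ, ∀ x, (Dom w x h ∨ Dom w h x) → (e x = 0 ∧ Dom w x h ∨ e x = 1 ∧ Dom w h x) := by
  classical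
  refine ⟨fun x => if Dom w x h then 0 else 1, fun x hx => ?_⟩
  by_cases h1 : Dom w x h <;> simp_all

theorem sdom_of {V : Type*} [DecidableEq V] (w : List V) (h : V) (e : V → ℕ) (x y : V)
    (hx : e x = 0 ∧ Dom w x h ∨ e x = 1 ∧ Dom w h x)
    (hy : e y = 0 ∧ Dom w y h ∨ e y = 1 ∧ Dom w h y)
    (hxy : Dom w x y ∨ Dom w y x) : SDom w e x y ∨ SDom w e y x := by
  rcases hx with ⟨ex, hx⟩ | ⟨ex, hx⟩ <;> rcases hy with ⟨ey, hy⟩ | ⟨ey, hy⟩ <;>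
  rcases hxy with hxy | hxy <;>
  first
  | (left; intro p hp
     have := hx p hp; have := hy p hp; have := hxy p hp
     omega)
  | (right; intro p hp
     have := hx p hp; have := hy p hp; have := hxy p hp
     omega)

theorem sdom_trans {V : Type*} [DecidableEq V] (w : List V) (h : V) (e : V → ℕ) (x y z : V)
    (hx : e x = 0 ∧ Dom w x h ∨ e x = 1 ∧ Dom w h x)
    (hz : e z = 0 ∧ Dom w z h ∨ e z = 1 ∧ Dom w h z)
    (hxy : SDom w e x y) (hyz : SDom w e y z) : Dom w x z ∨ Dom w z x := by
  have n1 := hxy [] (by simp)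
  have n2 := hyz [] (by simp)
  simp only [List.count_nil] at n1 n2
  rcases hx with ⟨ex, hx⟩ | ⟨ex, hx⟩ <;> rcases hz with ⟨ez, hz⟩ | ⟨ez, hz⟩ <;>
  first
  | (exfalso; omega)
  | (left; intro p hp
     have := hx p hp; have := hz p hp; have := hxy p hp; have := hyz p hp
     omega)
  | (right; intro p hp
     have := hx p hp; have := hz p hp; have := hxy p hp; have := hyz p hp
     omega)

instance : DecidableRel graphA8.Adj := fun a b => by
  unfold graphA8 graphOfList
  simp only [SimpleGraph.comap_adj, SimpleGraph.fromRel_adj]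
  infer_instance

instance : DecidableRel (wheelGraph 5).Adj := fun a b => by
  unfold wheelGraph
  simp only [SimpleGraph.fromRel_adj]
  rcases a with a | a <;> rcases b with b | b <;> dsimp only <;> infer_instance

def wheelMap : Fin 5 ⊕ Unit → {p : Fin 4 × Fin 3 | p ≠ (3, 0)}
  | Sum.inl i => (![⟨(0, 1), by simp⟩, ⟨(1, 0), by simp⟩, ⟨(2, 0), by simp⟩, ⟨(2, 1), by simp⟩,
      ⟨(1, 2), by simp⟩] : Fin 5 → {p : Fin 4 × Fin 3 | p ≠ (3, 0)}) i
  | Sum.inr _ => ⟨(1, 1), by simp⟩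

theorem wheelMap_inj : ∀ a b, wheelMap a = wheelMap b → a = b := by decide

theorem wheelMap_adj : ∀ a b, graphA8.Adj (wheelMap a) (wheelMap b) ↔ (wheelGraph 5).Adj a b := by
  decide

theorem no_col : ∀ a b c d e f : Fin 3, a ≠ b → b ≠ c → c ≠ d → d ≠ e → e ≠ a →
    f ≠ a → f ≠ b → f ≠ c → f ≠ d → f ≠ e → False := by
  intro a b c d e f
  omega

theorem prop5 {a b c d e a' b' c' d' e' : Prop} (s0 : a ∨ a') (s1 : b ∨ b') (s2 : c ∨ c')
    (s3 : d ∨ d') (s4 : e ∨ e') (t0 : a → b → False) (t1 : b → c → False) (t2 : c → d → False)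
    (t3 : d → e → False) (t4 : e → a → False) (r0 : b' → a' → False) (r1 : c' → b' → False)
    (r2 : d' → c' → False) (r3 : e' → d' → False) (r4 : a' → e' → False) : False := by
  grind

/-- The graph `A8` contains the wheel `W_5` as an induced subgraph; consequently `A8`
is not 3-colourable and is not word-representable. -/
theorem graphA8_wheel5_not_colorable_not_wordRepresentable :
    Nonempty (wheelGraph 5 ↪g graphA8) ∧
      ¬ graphA8.Colorable 3 ∧ ¬ WordRepresentable graphA8 := by
  refine ⟨⟨⟨⟨wheelMap, fun a b => wheelMap_inj a b⟩, fun {a b} => wheelMap_adj a b⟩⟩, ?_, ?_⟩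
  · rintro ⟨C⟩
    have H : ∀ a b, (wheelGraph 5).Adj a b → C (wheelMap a) ≠ C (wheelMap b) :=
      fun a b hab => C.valid ((wheelMap_adj a b).2 hab)
    exact no_col (C (wheelMap (.inl 0))) (C (wheelMap (.inl 1))) (C (wheelMap (.inl 2)))
      (C (wheelMap (.inl 3))) (C (wheelMap (.inl 4))) (C (wheelMap (.inr ())))
      (H _ _ (by decide)) (H _ _ (by decide)) (H _ _ (by decide)) (H _ _ (by decide))
      (H _ _ (by decide)) (H _ _ (by decide)) (H _ _ (by decide)) (H _ _ (by decide))
      (H _ _ (by decide)) (H _ _ (by decide))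
  · rintro ⟨w, -, hw⟩
    have H : ∀ a b, a ≠ b → ((wheelGraph 5).Adj a b ↔
        (Dom w (wheelMap a) (wheelMap b) ∨ Dom w (wheelMap b) (wheelMap a))) := by
      intro a b hab
      have hne : wheelMap a ≠ wheelMap b := fun h => hab (wheelMap_inj a b h)
      rw [← wheelMap_adj, hw _ _ hne, alternates_iff _ _ _ hne]
    obtain ⟨e, he⟩ := exists_shift w (wheelMap (.inr ()))
    have hub : ∀ i : Fin 5, _ := fun i => he (wheelMap (.inl i))
      ((H (.inl i) (.inr ()) (by simp)).1 (by revert i; decide))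
    have S : ∀ i j : Fin 5, (wheelGraph 5).Adj (.inl i) (.inl j) →
        (SDom w e (wheelMap (.inl i)) (wheelMap (.inl j)) ∨
          SDom w e (wheelMap (.inl j)) (wheelMap (.inl i))) := fun i j hij =>
      sdom_of w _ e _ _ (hub i) (hub j) ((H _ _ hij.ne).1 hij)
    have T : ∀ i j k : Fin 5, i ≠ k → ¬ (wheelGraph 5).Adj (.inl i) (.inl k) →
        SDom w e (wheelMap (.inl i)) (wheelMap (.inl j)) →
        SDom w e (wheelMap (.inl j)) (wheelMap (.inl k)) → False := fun i j k hne hik h1 h2 =>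
      hik ((H (.inl i) (.inl k) (by simpa using hne)).2
        (sdom_trans w _ e _ _ _ (hub i) (hub k) h1 h2))
    have s0 := S 0 1 (by decide)
    have s1 := S 1 2 (by decide)
    have s2 := S 2 3 (by decide)
    have s3 := S 3 4 (by decide)
    have s4 := S 4 0 (by decide)
    have t0 := T 0 1 2 (by decide) (by decide)
    have t1 := T 1 2 3 (by decide) (by decide)
    have t2 := T 2 3 4 (by decide) (by decide)
    have t3 := T 3 4 0 (by decide) (by decide)
    have t4 := T 4 0 1 (by decide) (by decide)
    have r0 := T 2 1 0 (by decide) (by decide)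
    have r1 := T 3 2 1 (by decide) (by decide)
    have r2 := T 4 3 2 (by decide) (by decide)
    have r3 := T 0 4 3 (by decide) (by decide)
    have r4 := T 1 0 4 (by decide) (by decide)
    clear S T hub he H hw
    exact prop5 s0 s1 s2 s3 s4 t0 t1 t2 t3 t4 r0 r1 r2 r3 r4
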